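/- arXiv:2004.03558 — 5 statements merged into one kernel-verified Lean document; each statement's English description precedes it below -/
import Mathlib

section
/- Let R be an m×m symmetric positive definite real matrix, U ⊆ ℝ^m a nonempty closed convex set, F ∈ ℝ^d, G a d×m real matrix, L ∈ ℝ, and q ∈ ℝ^d. Suppose w ∈ U satisfies qᵀ(F + Gw) + L + wᵀRw = 0, and set p = P_U(−(1/2)R⁻¹Gᵀq). Then qᵀ(F + Gp) ≤ −L − pᵀRp − (p − w)ᵀR(p − w). -/
open Matrix

/-- The R-weighted squared norm `uᵀRu`. -/
def rnormSq {m : ℕ} (R : Matrix (Fin m) (Fin m) ℝ) (u : Fin m → ℝ) : ℝ :=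
  u ⬝ᵥ R.mulVec u

/-- `p` is the R-projection of `v` onto `U`: `p ∈ U` and `p` minimizes the
R-weighted distance to `v` over `U`. -/
def IsRProj {m : ℕ} (R : Matrix (Fin m) (Fin m) ℝ) (U : Set (Fin m → ℝ))
    (v p : Fin m → ℝ) : Prop :=
  p ∈ U ∧ ∀ w ∈ U, rnormSq R (v - p) ≤ rnormSq R (v - w)

/-- For a symmetric matrix, the associated bilinear form is symmetric. -/
theorem dotProduct_mulVec_symm {m : ℕ} {R : Matrix (Fin m) (Fin m) ℝ} (hR : R.IsSymm)
    (a b : Fin m → ℝ) : a ⬝ᵥ R.mulVec b = b ⬝ᵥ R.mulVec a := by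
  rw [dotProduct_mulVec, ← mulVec_transpose, hR.eq, dotProduct_comm]

/-- The variational inequality characterizing the `R`-projection onto a convex set. -/
theorem IsRProj.dotProduct_mulVec_nonpos {m : ℕ} {R : Matrix (Fin m) (Fin m) ℝ}
    (hR : R.PosSemidef) {U : Set (Fin m → ℝ)} (hU : Convex ℝ U) {v p w : Fin m → ℝ}
    (hp : IsRProj R U v p) (hw : w ∈ U) : (v - p) ⬝ᵥ R.mulVec (w - p) ≤ 0 := by
  have hsymm : R.IsSymm := by simpa [IsHermitian, IsSymm] using hR.isHermitian
  set a := v - p with ha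
  set b := w - p with hb
  have hD : 0 ≤ b ⬝ᵥ R.mulVec b := by simpa using hR.dotProduct_mulVec_nonneg b
  have key : ∀ t : ℝ, 0 ≤ t → t ≤ 1 →
      2 * t * (a ⬝ᵥ R.mulVec b) ≤ t ^ 2 * (b ⬝ᵥ R.mulVec b) := by
    intro t ht0 ht1
    have h := hp.2 _ (hU.add_smul_sub_mem hp.1 hw ⟨ht0, ht1⟩)
    have hab : v - (p + t • (w - p)) = a - t • b := by rw [ha, hb]; abel
    rw [hab, ← ha] at h
    simp only [rnormSq, mulVec_sub, mulVec_smul, dotProduct_sub, sub_dotProduct,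
      smul_dotProduct, dotProduct_smul, smul_eq_mul, dotProduct_mulVec_symm hsymm b a] at h
    linarith
  by_contra! hc
  set c := a ⬝ᵥ R.mulVec b
  set D := b ⬝ᵥ R.mulVec b
  have hcD : 0 < c + D := by linarith
  have ht : 0 < c / (c + D) := div_pos hc hcD
  have h := key (c / (c + D)) ht.le ((div_le_one hcD).2 (by linarith))
  have hmul : c / (c + D) * (c + D) = c := div_mul_cancel₀ c hcD.ne'
  nlinarith [mul_pos ht hc, mul_pos ht (mul_pos ht hc)]

/-- If `w ∈ U` satisfies `qᵀ(F + Gw) + L + wᵀRw = 0` and `p = P_U(−(1/2)R⁻¹Gᵀq)`,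
then `qᵀ(F + Gp) ≤ −L − pᵀRp − (p − w)ᵀR(p − w)`. -/
theorem stmt6 {d m : ℕ} (R : Matrix (Fin m) (Fin m) ℝ) (hR : R.PosDef)
    (U : Set (Fin m → ℝ)) (hUne : U.Nonempty) (hUcl : IsClosed U) (hUco : Convex ℝ U)
    (F : Fin d → ℝ) (G : Matrix (Fin d) (Fin m) ℝ) (L : ℝ) (q : Fin d → ℝ)
    (w : Fin m → ℝ) (hw : w ∈ U)
    (hGHJB : q ⬝ᵥ (F + G.mulVec w) + L + w ⬝ᵥ R.mulVec w = 0)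
    (p : Fin m → ℝ)
    (hp : IsRProj R U (-(1 / 2 : ℝ) • R⁻¹.mulVec (Gᵀ.mulVec q)) p) :
    q ⬝ᵥ (F + G.mulVec p) ≤ -L - p ⬝ᵥ R.mulVec p - (p - w) ⬝ᵥ R.mulVec (p - w) := by
  have hsymm : R.IsSymm := by simpa [IsHermitian, IsSymm] using hR.isHermitian
  have hvar := hp.dotProduct_mulVec_nonpos hR.posSemidef hUco hw
  set v := -(1 / 2 : ℝ) • R⁻¹.mulVec (Gᵀ.mulVec q) with hv
  have hRv : R.mulVec v = -(1 / 2 : ℝ) • Gᵀ.mulVec q := by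
    rw [hv, mulVec_smul, mulVec_mulVec,
      mul_nonsing_inv R ((isUnit_iff_isUnit_det R).1 hR.isUnit), one_mulVec]
  have hG : ∀ x, q ⬝ᵥ G.mulVec x = -2 * (v ⬝ᵥ R.mulVec x) := by
    intro x
    rw [dotProduct_mulVec_symm hsymm, hRv, dotProduct_smul, mulVec_transpose,
      dotProduct_comm x, ← dotProduct_mulVec, smul_eq_mul]
    ring
  simp only [dotProduct_add, hG] at hGHJB ⊢
  simp only [mulVec_sub, dotProduct_sub, sub_dotProduct] at hvar ⊢
  linarith [dotProduct_mulVec_symm hsymm w p]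
end

section
/- Let f : ℝ^d → ℝ^d, ℓ : ℝ^d → ℝ with ℓ ≥ 0, and g : ℝ^d → ℝ^{d×m} be continuous, R an m×m symmetric positive definite real matrix, and U ⊆ ℝ^m a nonempty closed convex set. Let V : ℝ^d → ℝ be continuously differentiable with V ≥ 0, and let u : ℝ^d → U be continuous and satisfy the GHJB equation ∇V(z)ᵀ(f(z) + g(z)u(z)) + ℓ(z) + ‖u(z)‖_R² = 0 for all z ∈ ℝ^d. Define u⁺(z) := P_U(−(1/2)R⁻¹g(z)ᵀ∇V(z)), and let y : [0,∞) → ℝ^d be differentiable with y′(t) = f(y(t)) + g(y(t))u⁺(y(t)) for all t ≥ 0. Then for every T ≥ 0, ∫₀^T (ℓ(y(t)) + ‖u⁺(y(t))‖_R²) dt ≤ V(y(0)). -/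
open Matrix MeasureTheory

/-- Expansion of the `R`-weighted squared distance for symmetric `R`. -/
theorem rnormSq_sub {m : ℕ} {R : Matrix (Fin m) (Fin m) ℝ} (hR : Rᵀ = R) (v w : Fin m → ℝ) :
    rnormSq R (v - w) = rnormSq R v - 2 * (R.mulVec v ⬝ᵥ w) + rnormSq R w := by
  have hsymm : v ⬝ᵥ R.mulVec w = R.mulVec v ⬝ᵥ w := by
    rw [dotProduct_mulVec, ← mulVec_transpose, hR]
  simp only [rnormSq, mulVec_sub, dotProduct_sub, sub_dotProduct]
  rw [hsymm, dotProduct_comm w (R.mulVec v)]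
  ring

/-- The `R`-projection of `-(1/2) R⁻¹ q` onto `U` minimizes `w ↦ q ⬝ᵥ w + ‖w‖_R²` over `U`. -/
theorem IsRProj.dotProduct_add_rnormSq_le {m : ℕ} {R : Matrix (Fin m) (Fin m) ℝ}
    (hR : R.PosDef) {U : Set (Fin m → ℝ)} {q p w : Fin m → ℝ}
    (hp : IsRProj R U (-(1 / 2 : ℝ) • R⁻¹.mulVec q) p) (hw : w ∈ U) :
    q ⬝ᵥ p + rnormSq R p ≤ q ⬝ᵥ w + rnormSq R w := by
  have hT : Rᵀ = R := by simpa using hR.isHermitian.eq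
  have hRv : R.mulVec (-(1 / 2 : ℝ) • R⁻¹.mulVec q) = -(1 / 2 : ℝ) • q := by
    rw [mulVec_smul, mulVec_mulVec, mul_nonsing_inv R ((isUnit_iff_isUnit_det R).mp hR.isUnit),
      one_mulVec]
  have h := hp.2 w hw
  rw [rnormSq_sub hT, rnormSq_sub hT, hRv, smul_dotProduct, smul_dotProduct, smul_eq_mul,
    smul_eq_mul] at h
  linarith

/-- If `(V, u₀)` solves the GHJB equation with `V ≥ 0`, `ℓ ≥ 0`, and `y` solves
the closed-loop ODE for the improved (projected) policy
`u⁺(z) = P_U(−(1/2)R⁻¹g(z)ᵀ∇V(z))`, then for every `T ≥ 0`,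
`∫₀^T (ℓ(y(t)) + ‖u⁺(y(t))‖_R²) dt ≤ V(y(0))`. -/
theorem stmt7 {d m : ℕ}
    (f : (Fin d → ℝ) → (Fin d → ℝ)) (hf : Continuous f)
    (ℓ : (Fin d → ℝ) → ℝ) (hℓc : Continuous ℓ) (hℓnn : ∀ z, 0 ≤ ℓ z)
    (g : (Fin d → ℝ) → Matrix (Fin d) (Fin m) ℝ) (hg : Continuous g)
    (R : Matrix (Fin m) (Fin m) ℝ) (hR : R.PosDef)
    (U : Set (Fin m → ℝ)) (hUne : U.Nonempty) (hUcl : IsClosed U) (hUco : Convex ℝ U)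
    (V : (Fin d → ℝ) → ℝ) (hV : ContDiff ℝ 1 V) (hVnn : ∀ z, 0 ≤ V z)
    (DV : (Fin d → ℝ) → (Fin d → ℝ))
    (hDV : ∀ z w, fderiv ℝ V z w = DV z ⬝ᵥ w)
    (u0 : (Fin d → ℝ) → (Fin m → ℝ)) (hu0c : Continuous u0) (hu0U : ∀ z, u0 z ∈ U)
    (hGHJB : ∀ z, DV z ⬝ᵥ (f z + (g z).mulVec (u0 z)) + ℓ z + rnormSq R (u0 z) = 0)
    (u1 : (Fin d → ℝ) → (Fin m → ℝ))
    (hu1 : ∀ z, IsRProj R U (-(1 / 2 : ℝ) • R⁻¹.mulVec ((g z)ᵀ.mulVec (DV z))) (u1 z))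
    (y : ℝ → (Fin d → ℝ))
    (hy : ∀ t, 0 ≤ t → HasDerivAt y (f (y t) + (g (y t)).mulVec (u1 (y t))) t) :
    ∀ T, 0 ≤ T → (∫ t in (0 : ℝ)..T, (ℓ (y t) + rnormSq R (u1 (y t)))) ≤ V (y 0) := by
  intro T hT
  have hVy : ∀ t, 0 ≤ t → HasDerivAt (fun s ↦ -V (y s))
      (-(DV (y t) ⬝ᵥ (f (y t) + (g (y t)).mulVec (u1 (y t))))) t := by
    intro t ht
    have h := ((hV.differentiable one_ne_zero (y t)).hasFDerivAt.comp_hasDerivAt t (hy t ht)).neg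
    rwa [hDV] at h
  have hdecay : ∀ z, ℓ z + rnormSq R (u1 z) ≤ -(DV z ⬝ᵥ (f z + (g z).mulVec (u1 z))) := by
    intro z
    have h := (hu1 z).dotProduct_add_rnormSq_le hR (hu0U z)
    have hz := hGHJB z
    rw [mulVec_transpose, ← dotProduct_mulVec, ← dotProduct_mulVec] at h
    rw [dotProduct_add] at hz ⊢
    linarith
  by_cases hint : IntervalIntegrable (fun t ↦ ℓ (y t) + rnormSq R (u1 (y t))) volume 0 T
  · have h := intervalIntegral.integral_le_sub_of_hasDeriv_right_of_le hT
      (fun t ht ↦ (hVy t ht.1).continuousAt.continuousWithinAt)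
      (fun t ht ↦ (hVy t ht.1.le).hasDerivWithinAt)
      ((intervalIntegrable_iff_integrableOn_Icc_of_le hT).mp hint)
      (fun t _ ↦ hdecay (y t))
    linarith [hVnn (y T)]
  · rw [intervalIntegral.integral_undef hint]
    exact hVnn (y 0)
end

section
/- Let f : ℝ^d → ℝ^d, ℓ : ℝ^d → ℝ, and g : ℝ^d → ℝ^{d×m} be continuous, R an m×m symmetric positive definite real matrix, and u : ℝ^d → ℝ^m continuous. Let V : ℝ^d → ℝ be continuously differentiable with V(0) = 0 and satisfy the GHJB equation ∇V(z)ᵀ(f(z) + g(z)u(z)) + ℓ(z) + ‖u(z)‖_R² = 0 for all z ∈ ℝ^d. Let y : [0,∞) → ℝ^d be differentiable with y′(t) = f(y(t)) + g(y(t))u(y(t)) for all t ≥ 0, y(0) = x, and lim_{t→∞} y(t) = 0, and suppose t ↦ ℓ(y(t)) + ‖u(y(t))‖_R² is Lebesgue integrable on [0,∞). Then V(x) = ∫₀^∞ (ℓ(y(t)) + ‖u(y(t))‖_R²) dt. -/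
open Matrix MeasureTheory Filter

/-- If `(V, u)` solves the GHJB equation with `V(0) = 0` and the closed-loop
trajectory `y` starting at `x` converges to `0` with integrable running cost,
then `V(x) = ∫₀^∞ (ℓ(y(t)) + ‖u(y(t))‖_R²) dt`. -/
theorem stmt8 {d m : ℕ}
    (f : (Fin d → ℝ) → (Fin d → ℝ)) (hf : Continuous f)
    (ℓ : (Fin d → ℝ) → ℝ) (hℓc : Continuous ℓ)
    (g : (Fin d → ℝ) → Matrix (Fin d) (Fin m) ℝ) (hg : Continuous g)
    (R : Matrix (Fin m) (Fin m) ℝ) (hR : R.PosDef)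
    (u : (Fin d → ℝ) → (Fin m → ℝ)) (huc : Continuous u)
    (V : (Fin d → ℝ) → ℝ) (hV : ContDiff ℝ 1 V) (hV0 : V 0 = 0)
    (hGHJB : ∀ z, fderiv ℝ V z (f z + (g z).mulVec (u z)) + ℓ z + rnormSq R (u z) = 0)
    (x : Fin d → ℝ) (y : ℝ → (Fin d → ℝ))
    (hy : ∀ t, 0 ≤ t → HasDerivAt y (f (y t) + (g (y t)).mulVec (u (y t))) t)
    (hy0 : y 0 = x)
    (hylim : Tendsto y atTop (nhds 0))
    (hint : IntegrableOn (fun t => ℓ (y t) + rnormSq R (u (y t))) (Set.Ici 0)) :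
    V x = ∫ t in Set.Ioi (0 : ℝ), (ℓ (y t) + rnormSq R (u (y t))) := by
  have hderiv : ∀ t ∈ Set.Ici (0 : ℝ),
      HasDerivAt (fun t => -V (y t)) (ℓ (y t) + rnormSq R (u (y t))) t := fun t ht => by
    have hVy := ((hV.differentiable one_ne_zero (y t)).hasFDerivAt.comp_hasDerivAt t (hy t ht)).neg
    exact hVy.congr_deriv (by linarith [hGHJB (y t)])
  have hlim : Tendsto (fun t => -V (y t)) atTop (nhds 0) := by
    simpa [hV0] using ((hV.continuous.tendsto 0).comp hylim).neg
  rw [integral_Ioi_of_hasDerivAt_of_tendsto' hderiv (hint.mono_set Set.Ioi_subset_Ici_self) hlim,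
    hy0, zero_sub, neg_neg]
end

section
/- Let V : ℝ^d → ℝ and W : ℝ^d → ℝ be continuous with V(0) = 0, V(z) > 0 for all z ≠ 0, W(z) > 0 for all z ≠ 0, and V radially unbounded, i.e. V(z) → ∞ as ‖z‖ → ∞. Let y : [0,∞) → ℝ^d be continuous and satisfy V(y(T)) = V(y(0)) − ∫₀^T W(y(s)) ds for all T ≥ 0. Then lim_{T→∞} y(T) = 0. -/
open Filter MeasureTheory

/-- Sublevel sets of a continuous, radially unbounded function are compact. -/
theorem isCompact_sublevel_of_tendsto_comap_norm {E : Type*} [NormedAddCommGroup E]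
    [ProperSpace E] {V : E → ℝ} (hVc : Continuous V)
    (hV : Tendsto V (comap (fun z : E => ‖z‖) atTop) atTop) (a : ℝ) :
    IsCompact {z | V z ≤ a} := by
  rw [comap_norm_atTop] at hV
  refine Metric.isCompact_of_isClosed_isBounded (isClosed_le hVc continuous_const) ?_
  rw [← Bornology.isCobounded_compl_iff]
  filter_upwards [hV.eventually_gt_atTop a] with z hz
  simpa using hz

/-- A continuous function that is positive on a compact set has a positive lower bound there. -/
theorem IsCompact.exists_pos_forall_le {X : Type*} [TopologicalSpace X] {K : Set X}
    (hK : IsCompact K) {f : X → ℝ} (hf : Continuous f) (hpos : ∀ x ∈ K, 0 < f x) :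
    ∃ m, 0 < m ∧ ∀ x ∈ K, m ≤ f x := by
  rcases K.eq_empty_or_nonempty with rfl | hne
  · exact ⟨1, one_pos, by simp⟩
  · obtain ⟨x, hx, hmin⟩ := hK.exists_isMinOn hne hf.continuousOn
    exact ⟨f x, hpos x hx, fun z hz => hmin hz⟩

/-- A continuous function that is positive off a non-isolated point is nonnegative. -/
theorem Continuous.nonneg_of_pos_off_point {X : Type*} [TopologicalSpace X] {f : X → ℝ}
    (hf : Continuous f) {a : X} [(nhdsWithin a {a}ᶜ).NeBot] (hpos : ∀ z, z ≠ a → 0 < f z)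
    (z : X) : 0 ≤ f z := by
  rcases eq_or_ne z a with rfl | hz
  · refine ge_of_tendsto (x := nhdsWithin z {z}ᶜ)
      (hf.continuousAt.tendsto.mono_left nhdsWithin_le_nhds) ?_
    filter_upwards [self_mem_nhdsWithin] with w hw using (hpos w hw).le
  · exact (hpos z hz).le

/-- Lyapunov-type stabilization: if `V` is continuous, positive definite and
radially unbounded, `W` is continuous and positive off the origin, and along the
continuous trajectory `y` one has `V(y(T)) = V(y(0)) − ∫₀^T W(y(s)) ds` for all
`T ≥ 0`, then `y(T) → 0` as `T → ∞`. -/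
theorem stmt9 {d : ℕ}
    (V W : (Fin d → ℝ) → ℝ) (hVc : Continuous V) (hWc : Continuous W)
    (hV0 : V 0 = 0) (hVpos : ∀ z, z ≠ 0 → 0 < V z) (hWpos : ∀ z, z ≠ 0 → 0 < W z)
    (hVrad : Tendsto V (comap (fun z : Fin d → ℝ => ‖z‖) atTop) atTop)
    (y : ℝ → (Fin d → ℝ)) (hyc : Continuous y)
    (hyV : ∀ T, 0 ≤ T → V (y T) = V (y 0) - ∫ s in (0 : ℝ)..T, W (y s)) :
    Tendsto y atTop (nhds 0) := by
  rcases subsingleton_or_nontrivial (Fin d → ℝ) with hsub | hnt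
  · rw [show y = fun _ => 0 from funext fun _ => Subsingleton.elim _ _]
    exact tendsto_const_nhds
  have : (nhdsWithin (0 : Fin d → ℝ) {0}ᶜ).NeBot := Module.punctured_nhds_neBot ℝ _ 0
  have hWnn := hWc.nonneg_of_pos_off_point hWpos
  have hint : ∀ a b, IntervalIntegrable (fun s => W (y s)) volume a b :=
    fun a b => (hWc.comp hyc).intervalIntegrable a b
  have hanti : ∀ s t, 0 ≤ s → s ≤ t → V (y t) ≤ V (y s) := by
    intro s t hs hst
    have hadd := intervalIntegral.integral_add_adjacent_intervals (hint 0 s) (hint s t)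
    have hnn : 0 ≤ ∫ r in s..t, W (y r) :=
      intervalIntegral.integral_nonneg hst fun r _ => hWnn _
    linarith [hyV s hs, hyV t (hs.trans hst)]
  have hVnn := hVc.nonneg_of_pos_off_point hVpos
  have hK := isCompact_sublevel_of_tendsto_comap_norm hVc hVrad (V (y 0))
  have hsmall : ∀ ε > 0, ∃ T, 0 ≤ T ∧ V (y T) < ε := by
    intro ε hε
    by_contra! hlarge
    obtain ⟨m, hm, hmW⟩ := (hK.inter_right
      (isClosed_le continuous_const hVc : IsClosed {z | ε ≤ V z})).exists_pos_forall_le hWc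
      (fun z hz => hWpos z fun h0 => by
        have h := hz.2
        simp only [Set.mem_ofPred_eq, h0, hV0] at h
        linarith)
    have hdecay : ∀ T, 0 ≤ T → V (y T) ≤ V (y 0) - T * m := by
      intro T hT
      have h := intervalIntegral.integral_mono_on hT
        (intervalIntegrable_const (c := m)) (hint 0 T)
        fun s hs => hmW _ ⟨hanti 0 s le_rfl hs.1, hlarge s hs.1⟩
      rw [intervalIntegral.integral_const, smul_eq_mul, sub_zero] at h
      linarith [hyV T hT]
    have hT : 0 ≤ V (y 0) / m := div_nonneg (hVnn _) hm.le
    have h := hdecay _ hT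
    rw [div_mul_cancel₀ _ hm.ne'] at h
    linarith [hlarge _ hT]
  rw [Metric.tendsto_atTop]
  intro r hr
  obtain ⟨m, hm, hmV⟩ := (hK.inter_right
    (Metric.isOpen_ball (x := (0 : Fin d → ℝ)) (ε := r)).isClosed_compl).exists_pos_forall_le hVc
    (fun z hz => hVpos z fun h0 => hz.2 (h0 ▸ Metric.mem_ball_self hr))
  obtain ⟨T, hT, hTm⟩ := hsmall m hm
  refine ⟨T, fun t ht => ?_⟩
  by_contra hfar
  linarith [hmV (y t) ⟨hanti 0 t le_rfl (hT.trans ht), hfar⟩, hanti T t hT ht]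
end

section
/- Let Ω ⊆ ℝ^d be open, let V_i : Ω → ℝ (i ∈ ℕ) be differentiable on Ω, and let V̄ : Ω → ℝ be differentiable on Ω with continuous gradient ∇V̄. Assume V_i → V̄ uniformly on Ω and that the family of gradients {∇V_i : i ∈ ℕ} is equicontinuous on Ω. Then for every x ∈ Ω, ∇V_i(x) → ∇V̄(x) as i → ∞. -/
open Filter

open Topology in
/-- If functions converge uniformly near `x` and their derivatives are equicontinuous at `x`, then
their derivatives at `x` converge to the derivative of the limit. -/
theorem tendsto_fderiv_of_tendstoUniformlyOn_of_equicontinuousAt {ι E F : Type*}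
    [NormedAddCommGroup E] [NormedSpace ℝ E] [NormedAddCommGroup F] [NormedSpace ℝ F]
    {l : Filter ι} {f : ι → E → F} {g : E → F} {s : Set E} {x : E} (hs : s ∈ 𝓝 x)
    (hf : ∀ i, ∀ y ∈ s, DifferentiableAt ℝ (f i) y) (hg : DifferentiableAt ℝ g x)
    (hfg : TendstoUniformlyOn f g l s)
    (hequi : EquicontinuousAt (fun i y => fderiv ℝ (f i) y) x) :
    Tendsto (fun i => fderiv ℝ (f i) x) l (𝓝 (fderiv ℝ g x)) := by
  rw [Metric.tendsto_nhds]
  intro ε hε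
  have hnear : ∀ᶠ y in 𝓝 x, y ∈ s ∧
      (∀ i, dist (fderiv ℝ (f i) x) (fderiv ℝ (f i) y) < ε / 4) ∧
      ‖g y - g x - fderiv ℝ g x (y - x)‖ ≤ ε / 4 * ‖y - x‖ :=
    (eventually_mem_set.2 hs).and <|
      (Metric.equicontinuousAt_iff_right.1 hequi (ε / 4) (by positivity)).and
        (hg.hasFDerivAt.isLittleO.def (by positivity))
  obtain ⟨r, hr, hball⟩ := Metric.eventually_nhds_iff_ball.1 hnear
  have hx : x ∈ Metric.ball x r := Metric.mem_ball_self hr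
  filter_upwards [Metric.tendstoUniformlyOn_iff.1 hfg (ε * r / 16) (by positivity)] with i hi
  suffices h : ‖fderiv ℝ (f i) x - fderiv ℝ g x‖ ≤ 3 * ε / 4 by
    rw [dist_eq_norm]
    linarith
  refine ContinuousLinearMap.opNorm_le_of_shell (c := (2 : ℝ)) hr (by positivity)
    (by norm_num) fun v hv hvr => ?_
  have hy : x + v ∈ Metric.ball x r := by simpa using hvr
  have hmean : ‖f i (x + v) - f i x - fderiv ℝ (f i) x (x + v - x)‖ ≤ ε / 4 * ‖x + v - x‖ :=
    (convex_ball x r).norm_image_sub_le_of_norm_fderiv_le'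
      (fun y hy => hf i y (hball y hy).1)
      (fun y hy => by
        rw [← dist_eq_norm, dist_comm]
        exact ((hball y hy).2.1 i).le) hx hy
  have hlin := (hball _ hy).2.2
  have hfgx := hi x (hball x hx).1
  have hfgy := hi _ (hball _ hy).1
  rw [add_sub_cancel_left] at hmean hlin
  rw [dist_eq_norm] at hfgx hfgy
  rw [Real.norm_ofNat] at hv
  calc ‖(fderiv ℝ (f i) x - fderiv ℝ g x) v‖
      = ‖(g (x + v) - g x - fderiv ℝ g x v) - (f i (x + v) - f i x - fderiv ℝ (f i) x v)
          - (g (x + v) - f i (x + v)) + (g x - f i x)‖ := by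
        rw [sub_apply]
        congr 1
        abel
    _ ≤ ‖g (x + v) - g x - fderiv ℝ g x v‖ + ‖f i (x + v) - f i x - fderiv ℝ (f i) x v‖
          + ‖g (x + v) - f i (x + v)‖ + ‖g x - f i x‖ := by
        refine (norm_add_le _ _).trans ?_
        gcongr
        refine (norm_sub_le _ _).trans ?_
        gcongr
        exact norm_sub_le _ _
    _ ≤ ε / 4 * ‖v‖ + ε / 4 * ‖v‖ + ε * r / 16 + ε * r / 16 := by gcongr
    _ ≤ 3 * ε / 4 * ‖v‖ := by nlinarith

/-- If `V_i → V̄` uniformly on an open set `Ω`, the `V_i` and `V̄` are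
differentiable on `Ω`, `∇V̄` is continuous on `Ω`, and the family `{∇V_i}` is
equicontinuous on `Ω`, then `∇V_i(x) → ∇V̄(x)` for every `x ∈ Ω`. -/
theorem stmt12 {d : ℕ} (Ω : Set (Fin d → ℝ)) (hΩ : IsOpen Ω)
    (V : ℕ → (Fin d → ℝ) → ℝ) (Vbar : (Fin d → ℝ) → ℝ)
    (hVdiff : ∀ i, ∀ x ∈ Ω, DifferentiableAt ℝ (V i) x)
    (hVbardiff : ∀ x ∈ Ω, DifferentiableAt ℝ Vbar x)
    (hVbargrad : ContinuousOn (fun x => fderiv ℝ Vbar x) Ω)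
    (hunif : TendstoUniformlyOn (fun i x => V i x) Vbar atTop Ω)
    (hequi : ∀ x ∈ Ω, ∀ ε > 0, ∃ δ > 0, ∀ i : ℕ, ∀ x' ∈ Ω,
      ‖x - x'‖ < δ → ‖fderiv ℝ (V i) x - fderiv ℝ (V i) x'‖ < ε) :
    ∀ x ∈ Ω, Tendsto (fun i => fderiv ℝ (V i) x) atTop (nhds (fderiv ℝ Vbar x)) := by
  intro x hx
  refine tendsto_fderiv_of_tendstoUniformlyOn_of_equicontinuousAt (hΩ.mem_nhds hx) hVdiff
    (hVbardiff x hx) hunif (Metric.equicontinuousAt_iff_right.2 fun ε hε => ?_)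
  obtain ⟨δ, hδ, h⟩ := hequi x hx ε hε
  filter_upwards [hΩ.mem_nhds hx, Metric.ball_mem_nhds x hδ] with y hy hyδ i
  rw [dist_eq_norm]
  exact h i y hy (by rwa [← dist_eq_norm, dist_comm])
end
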